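/- For every real x with −π < x < π, the series Σ_{n=1}^∞ (−1)^{n+1} · cos(n x)/n converges and its sum equals log(2·cos(x/2)). -/

import Mathlib

open Filter Topology in
/-- The Taylor series of `-log (1 - z)` converges at every point `z ≠ 1` of the unit circle. -/
theorem Complex.tendsto_sum_pow_div_neg_log_one_sub {z : ℂ} (hz : ‖z‖ = 1) (hz1 : z ≠ 1) :
    Tendsto (fun N : ℕ => ∑ n ∈ Finset.range N, z ^ (n + 1) / ((n : ℂ) + 1)) atTop
      (𝓝 (-Complex.log (1 - z))) := by
  have hcauchy : CauchySeq fun N : ℕ =>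
      ∑ n ∈ Finset.range N, (1 / ((n : ℝ) + 1)) • z ^ (n + 1) := by
    refine Antitone.cauchySeq_series_mul_of_tendsto_zero_of_bounded (b := 2 / ‖z - 1‖)
      (fun m n hmn => by gcongr) tendsto_one_div_add_atTop_nhds_zero_nat fun n => ?_
    simp_rw [pow_succ, ← Finset.sum_mul]
    rw [geom_sum_eq hz1, norm_mul, hz, mul_one, norm_div]
    gcongr
    calc ‖z ^ n - 1‖ ≤ ‖z ^ n‖ + ‖(1 : ℂ)‖ := norm_sub_le _ _
      _ = 2 := by rw [norm_pow, hz]; norm_num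
  obtain ⟨l, hl⟩ := cauchySeq_tendsto_of_complete hcauchy
  replace hl : Tendsto (fun N : ℕ => ∑ n ∈ Finset.range N, z ^ (n + 1) / ((n : ℂ) + 1)) atTop
      (𝓝 l) := by
    refine hl.congr fun N => Finset.sum_congr rfl fun n _ => ?_
    rw [Complex.real_smul]
    push_cast
    ring
  have habel := tendsto_map'_iff.mp (Complex.tendsto_tsum_powerSeries_nhdsWithin_lt hl)
  have hofReal : Tendsto (fun r : ℝ => (r : ℂ)) (𝓝[<] 1) (𝓝 1) :=
    (Complex.continuous_ofReal.tendsto' 1 1 Complex.ofReal_one).mono_left nhdsWithin_le_nhds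
  have hlim := habel.mul hofReal
  rw [mul_one] at hlim
  have hlog : Tendsto (fun r : ℝ => -Complex.log (1 - r * z)) (𝓝[<] 1) (𝓝 l) := by
    refine hlim.congr' ?_
    filter_upwards [Ioo_mem_nhdsLT (show (0 : ℝ) < 1 by norm_num)] with r hr
    have hrz : ‖(r : ℂ) * z‖ < 1 := by
      rw [norm_mul, hz, mul_one, Complex.norm_real, Real.norm_of_nonneg hr.1.le]
      exact hr.2
    rw [← (Complex.hasSum_taylorSeries_neg_log' hrz).tsum_eq, Function.comp_apply,
      ← tsum_mul_right]
    exact tsum_congr fun n => by ring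
  have hre : z.re < 1 := by
    refine lt_of_le_of_ne (hz ▸ Complex.re_le_norm z) fun h => hz1 ?_
    have him := Complex.sq_norm_sub_sq_re z
    rw [hz, h] at him
    exact Complex.ext h (by simpa using him.symm)
  have hslit : 1 - z ∈ Complex.slitPlane := Or.inl (by simpa using hre)
  have hcont : Tendsto (fun r : ℝ => -Complex.log (1 - r * z)) (𝓝[<] 1)
      (𝓝 (-Complex.log (1 - z))) := by
    have h := (hofReal.mul_const z).const_sub 1
    rw [one_mul] at h
    exact (h.clog hslit).neg
  rwa [tendsto_nhds_unique hlog hcont] at hl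

theorem Complex.norm_one_add_exp_mul_I (x : ℝ) :
    ‖1 + Complex.exp (x * Complex.I)‖ = |2 * Real.cos (x / 2)| := by
  have h : 1 + Complex.exp (x * Complex.I) =
      Complex.exp ((x / 2 : ℝ) * Complex.I) * ((2 * Real.cos (x / 2) : ℝ) : ℂ) := by
    push_cast
    rw [Complex.two_cos, mul_add, ← Complex.exp_add, ← Complex.exp_add, add_comm]
    congr 1
    · congr 1
      ring
    · rw [neg_mul, add_neg_cancel, Complex.exp_zero]
  rw [h, norm_mul, Complex.norm_exp_ofReal_mul_I, one_mul, Complex.norm_real, Real.norm_eq_abs]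

theorem stmt_4 (x : ℝ) (h1 : -Real.pi < x) (h2 : x < Real.pi) :
    Filter.Tendsto
      (fun N : ℕ => ∑ n ∈ Finset.Icc 1 N,
        (-1 : ℝ) ^ (n + 1) * Real.cos ((n : ℝ) * x) / (n : ℝ))
      Filter.atTop (nhds (Real.log (2 * Real.cos (x / 2)))) := by
  have hcos : 0 < Real.cos (x / 2) := Real.cos_pos_of_mem_Ioo ⟨by linarith, by linarith⟩
  have hnorm : ‖1 + Complex.exp (x * Complex.I)‖ = 2 * Real.cos (x / 2) := by
    rw [Complex.norm_one_add_exp_mul_I, abs_of_pos (by positivity)]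
  have hne : -Complex.exp (x * Complex.I) ≠ 1 := fun h => by
    rw [neg_eq_iff_eq_neg.mp h, add_neg_cancel, norm_zero] at hnorm
    linarith
  have h := (Complex.continuous_re.tendsto _).comp
    (Complex.tendsto_sum_pow_div_neg_log_one_sub
      (by rw [norm_neg, Complex.norm_exp_ofReal_mul_I]) hne).neg
  rw [neg_neg, sub_neg_eq_add, Complex.log_re, hnorm] at h
  refine h.congr fun N => ?_
  rw [Function.comp_apply, Complex.neg_re, Complex.re_sum, ← Finset.sum_neg_distrib,
    Finset.range_eq_Ico, ← Finset.Ico_add_one_right_eq_Icc,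
    ← Finset.sum_Ico_add' _ 0 N 1]
  refine Finset.sum_congr rfl fun n _ => ?_
  have hterm : (-Complex.exp (x * Complex.I)) ^ (n + 1) / ((n : ℂ) + 1) =
      (((-1) ^ (n + 1) / ((n : ℝ) + 1) : ℝ) : ℂ) *
        Complex.exp (((n + 1 : ℕ) * x : ℝ) * Complex.I) := by
    rw [neg_pow, ← Complex.exp_nat_mul]
    push_cast
    ring_nf
  rw [hterm, Complex.re_ofReal_mul, Complex.exp_ofReal_mul_I_re]
  push_cast
  ring
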